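/- Let n ≥ 4 be an even integer, let G be an n-vertex graph with minimum degree δ(G) ≥ n/2 + 2, and let χ be an edge-coloring of G with 2 colors under which G contains no even-chromatic Hamilton cycle. Then for every pair of distinct vertices x, y ∈ V(G), either χ(xu) = χ(yu) for every common neighbor u of x and y, or χ(xu) ≠ χ(yu) for every common neighbor u of x and y. -/

import Mathlib

open Classical in
/-- Number of consecutive non-adjacent pairs of a list of vertices. -/
noncomputable def gapCount {V : Type*} (G : SimpleGraph V) : List V → ℕ
  | [] => 0
  | [_] => 0
  | x :: y :: t => (if G.Adj x y then 0 else 1) + gapCount G (y :: t)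

open Classical in
lemma gapCount_app {V : Type*} (G : SimpleGraph V) (P : List V) (p q : V) (S : List V) :
    gapCount G (P ++ p :: q :: S) =
      gapCount G (P ++ [p]) + (if G.Adj p q then 0 else 1) + gapCount G (q :: S) := by
  induction P with
  | nil => simp [gapCount]
  | cons x P ih =>
    cases P with
    | nil => simp [gapCount]; omega
    | cons y P =>
      simp only [List.cons_append, gapCount] at ih ⊢
      omega

lemma gapCount_reverse {V : Type*} (G : SimpleGraph V) (l : List V) :
    gapCount G l.reverse = gapCount G l := by
  classical
  induction l with
  | nil => rfl
  | cons x t ih =>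
    cases t with
    | nil => rfl
    | cons y t =>
      have := gapCount_app G t.reverse y x []
      simp only [List.reverse_cons, List.append_assoc, List.cons_append, List.nil_append] at ih this ⊢
      rw [this, ih]
      simp only [gapCount, G.adj_comm y x]
      omega

open Classical in
lemma gapCount_mid {V : Type*} (G : SimpleGraph V) (P M E E' S : List V) (p m1 m2 s : V)
    (h1 : M = m1 :: E) (h2 : M = E' ++ [m2]) :
    gapCount G (P ++ [p] ++ M ++ s :: S) =
      gapCount G (P ++ [p]) + (if G.Adj p m1 then 0 else 1) + gapCount G M
        + (if G.Adj m2 s then 0 else 1) + gapCount G (s :: S) := by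
  have e1 : P ++ [p] ++ M ++ s :: S = P ++ p :: m1 :: (E ++ s :: S) := by simp [h1]
  have e2 : m1 :: (E ++ s :: S) = E' ++ m2 :: s :: S := by
    rw [← List.cons_append, ← h1, h2]; simp
  rw [e1, gapCount_app, e2, gapCount_app, ← h2]
  omega

lemma swap_step {V : Type*} (G : SimpleGraph V) (P M E E' S : List V) (p m1 m2 s : V)
    (h1 : M = m1 :: E) (h2 : M = E' ++ [m2]) (hg : ¬ G.Adj p m1 ∨ ¬ G.Adj m2 s)
    (ha : G.Adj p m2) (hb : G.Adj m1 s) (L : List V) (hL : L = P ++ [p] ++ M ++ s :: S) :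
    ∃ L' : List V, L'.Perm L ∧ L'.head? = L.head? ∧ L'.getLast? = L.getLast? ∧
      gapCount G L' < gapCount G L := by
  classical
  refine ⟨P ++ [p] ++ M.reverse ++ s :: S, ?_, ?_, ?_, ?_⟩
  · subst hL
    exact ((List.reverse_perm M).append_left _).append_right _
  · subst hL; simp
  · subst hL
    rw [List.getLast?_append_of_ne_nil _ (by simp), List.getLast?_append_of_ne_nil _ (by simp)]
  · rw [hL, gapCount_mid G P M E E' S p m1 m2 s h1 h2,
      gapCount_mid G P M.reverse E'.reverse E.reverse S p m2 m1 s (by simp [h2]) (by simp [h1]),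
      gapCount_reverse]
    simp only [ha, hb, if_true]
    rcases hg with h | h <;> simp only [h, if_false] <;> omega

lemma count_bound {V : Type*} (p q : V → Prop) [DecidablePred p] [DecidablePred q] (t : List V) :
    ∀ x, (x :: t).IsChain (fun a b => ¬ (p a ∧ q b)) →
      (x :: t).countP (fun z => p z) + (x :: t).countP (fun z => q z)
        ≤ t.length + 1 + if q x then 1 else 0 := by
  induction t with
  | nil =>
    intro x _
    by_cases h1 : p x <;> by_cases h2 : q x <;> simp [h1, h2]
  | cons y t ih =>
    intro x h
    rw [List.isChain_cons_cons] at h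
    have h2 := ih y h.2
    have h3 := h.1
    rw [List.countP_cons (a := x), List.countP_cons (a := x)]
    rw [List.length_cons]
    by_cases a1 : p x <;> by_cases a2 : q x <;> by_cases a3 : q y <;>
      simp_all <;> omega

lemma improve {V : Type*} (G : SimpleGraph V) [DecidableRel G.Adj] (L : List V)
    (hdeg : ∀ a ∈ L, L.length + 1 ≤ 2 * L.countP (fun z => G.Adj a z))
    (hL : ¬ L.IsChain G.Adj) :
    ∃ L' : List V, L'.Perm L ∧ L'.head? = L.head? ∧ L'.getLast? = L.getLast? ∧
      gapCount G L' < gapCount G L := by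
  rw [List.isChain_iff_forall_rel_of_append_cons_cons] at hL
  push Not at hL
  obtain ⟨a, b, A, B, rfl, hab⟩ := hL
  by_cases c1 : (b :: B).IsChain (fun x y => ¬ (G.Adj a x ∧ G.Adj b y))
  · by_cases c2 : (A ++ [a]).IsChain (fun x y => ¬ (G.Adj a x ∧ G.Adj b y))
    · exfalso
      have b1 := count_bound _ _ _ _ c1
      have c3 : (a :: A.reverse).IsChain (fun x y => ¬ (G.Adj b x ∧ G.Adj a y)) := by
        have : a :: A.reverse = (A ++ [a]).reverse := by simp
        rw [this, List.isChain_reverse]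
        exact c2.imp (by tauto)
      have b2 := count_bound _ _ _ _ c3
      have d1 := hdeg a (by simp)
      have d2 := hdeg b (by simp)
      simp [List.countP_append, List.countP_cons, hab, G.adj_comm b a] at b1 b2 d1 d2
      omega
    · rw [List.isChain_iff_forall_rel_of_append_cons_cons] at c2
      push Not at c2
      obtain ⟨c, d, C, D, e, hc, hd⟩ := c2
      have hlast : ∃ D', d :: D = D' ++ [a] := by
        refine ⟨(d :: D).dropLast, ?_⟩
        have : a = (d :: D).getLast (by simp) := by
          have h := congrArg List.getLast? e
          have e' : C ++ c :: d :: D = (C ++ [c]) ++ d :: D := by simp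
          rw [e', List.getLast?_append_of_ne_nil _ (by simp), List.getLast?_append_of_ne_nil _ (by simp),
            List.getLast?_eq_some_getLast (l := d :: D) (by simp)] at h
          simpa using h
        conv_lhs => rw [← List.dropLast_append_getLast (l := d :: D) (by simp)]
        rw [← this]
      obtain ⟨D', hD'⟩ := hlast
      refine swap_step G C (d :: D) D D' B c d a b rfl hD' (Or.inr hab) hc.symm hd.symm _ ?_
      have : A ++ a :: b :: B = (A ++ [a]) ++ b :: B := by simp
      rw [this, e]; simp
  · rw [List.isChain_iff_forall_rel_of_append_cons_cons] at c1
    push Not at c1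
    obtain ⟨c, d, C, D, e, hc, hd⟩ := c1
    have hfirst : ∃ E, C ++ [c] = b :: E := by
      cases C with
      | nil => simp at e; exact ⟨[], by simp [e.1]⟩
      | cons x C => simp at e; exact ⟨C ++ [c], by simp [e.1]⟩
    obtain ⟨E, hE⟩ := hfirst
    refine swap_step G A (C ++ [c]) E C D a b c d hE rfl (Or.inl hab) hc hd _ ?_
    rw [e]; simp

lemma ham_list {V : Type*} (G : SimpleGraph V) [DecidableRel G.Adj] (k : ℕ) :
    ∀ (L : List V), gapCount G L = k → 
    (∀ a ∈ L, L.length + 1 ≤ 2 * L.countP (fun z => G.Adj a z)) →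
    ∃ L' : List V, L'.Perm L ∧ L'.head? = L.head? ∧ L'.getLast? = L.getLast? ∧
      L'.IsChain G.Adj := by
  induction k using Nat.strong_induction_on with
  | _ k ih =>
    intro L hk hdeg
    by_cases hL : L.IsChain G.Adj
    · exact ⟨L, .refl _, rfl, rfl, hL⟩
    obtain ⟨L1, h1, h2, h3, h4⟩ := improve G L hdeg hL
    obtain ⟨L2, g1, g2, g3, g4⟩ := ih _ (hk ▸ h4) L1 rfl (by
      intro a ha
      rw [h1.length_eq, h1.countP_eq]
      exact hdeg a (h1.mem_iff.1 ha))
    exact ⟨L2, g1.trans h1, g2.trans h2, g3.trans h3, g4⟩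

/-- Closing up a spanning path `p` of the complement of `{x, w, y}`. -/
lemma cycle_close {n : ℕ} (hne : Even n) (G : SimpleGraph (Fin n)) (χ : Sym2 (Fin n) → Fin 2)
    (hno : ¬ ∃ (a : Fin n) (w : G.Walk a a), w.IsHamiltonianCycle ∧
      ∀ c : Fin 2, Even ((w.edges.filter (fun e => χ e = c)).length))
    {u v x w y : Fin n} (p : G.Walk u v) (hp : p.IsPath)
    (hs : ∀ z, z ∈ p.support ↔ (z ≠ x ∧ z ≠ w ∧ z ≠ y)) (hxw : x ≠ w) (hxy : x ≠ y) (hwy : w ≠ y)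
    (h1 : G.Adj v x) (h2 : G.Adj x w) (h3 : G.Adj w y) (h4 : G.Adj y u) :
    ¬ Even (p.edges.countP (fun e => χ e = 0) + (if χ s(v, x) = 0 then 1 else 0) + (if χ s(x, w) = 0 then 1 else 0)
      + (if χ s(w, y) = 0 then 1 else 0) + (if χ s(y, u) = 0 then 1 else 0)) := by
  intro hev
  apply hno
  have hu := (hs u).1 p.start_mem_support
  have hv := (hs v).1 p.end_mem_support
  let q : G.Walk v y := .cons h1 (.cons h2 (.cons h3 .nil))
  let r : G.Walk u y := p.append q
  have hrs : r.support = p.support ++ [x, w, y] := by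
    simp [r, q, SimpleGraph.Walk.support_append]
  have hr : r.IsPath := by
    rw [SimpleGraph.Walk.isPath_def, hrs, List.nodup_append]
    refine ⟨hp.support_nodup, by simp [hxw, hxy, hwy], ?_⟩
    intro a ha b hb
    have := (hs a).1 ha
    simp at hb
    rintro rfl
    tauto
  have hH : r.IsHamiltonian := hr.isHamiltonian_of_mem (by
    intro z
    rw [hrs]
    have := hs z
    simp
    tauto)
  have hre : r.edges = p.edges ++ [s(v, x), s(x, w), s(w, y)] := by
    simp [r, q, SimpleGraph.Walk.edges_append]
  have hC : (SimpleGraph.Walk.cons h4 r).IsHamiltonianCycle := by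
    refine ⟨?_, ?_⟩
    · rw [SimpleGraph.Walk.cons_isCycle_iff]
      refine ⟨hr, ?_⟩
      rw [hre, List.mem_append]
      rintro (h | h)
      · have := (hs y).1 (p.fst_mem_support_of_mem_edges h)
        tauto
      · simp only [List.mem_cons, Sym2.eq_iff, List.not_mem_nil, or_false] at h
        grind
    · intro a
      simpa using hH a
  refine ⟨y, _, hC, ?_⟩
  have hlen : (SimpleGraph.Walk.cons h4 r).edges.length = n := by
    have := hC.length_eq
    rw [SimpleGraph.Walk.length_edges, this]; simp
  generalize hE : (SimpleGraph.Walk.cons h4 r).edges = E at *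
  have h0 : Even (E.countP (fun e => χ e = 0)) := by
    rw [← hE, SimpleGraph.Walk.edges_cons, hre]
    convert hev using 1
    simp only [List.countP_cons, List.countP_append, List.countP_nil, decide_eq_true_eq]
    omega
  have hsum := List.length_eq_countP_add_countP (l := E) (fun e => decide (χ e = 0))
  have h1' : E.countP (fun e => χ e = 1) = E.countP (fun e => ¬ (decide (χ e = 0)) = true) := by
    apply List.countP_congr
    intro e _
    generalize χ e = c
    revert c; decide
  intro c
  rw [← List.countP_eq_length_filter]
  fin_cases c
  · exact h0
  · change Even (E.countP (fun e => χ e = 1))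
    rw [h1']
    rw [hlen] at hsum
    rw [hsum, Nat.even_add] at hne
    exact hne.1 h0

/-- Let `n ≥ 4` be even, `G` an `n`-vertex graph with `δ(G) ≥ n/2 + 2`, and
`χ` a 2-coloring of its edges admitting no even-chromatic Hamilton cycle. Then
every pair of distinct vertices either agrees (`χ(xu) = χ(yu)` for all common
neighbors `u`) or disagrees (`χ(xu) ≠ χ(yu)` for all common neighbors `u`). -/
theorem agree_or_disagree_of_no_even_hamilton (n : ℕ) (hn : 4 ≤ n) (hne : Even n)
    (G : SimpleGraph (Fin n)) [DecidableRel G.Adj]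
    (hδ : n / 2 + 2 ≤ G.minDegree)
    (χ : Sym2 (Fin n) → Fin 2)
    (hno : ¬ ∃ (a : Fin n) (w : G.Walk a a), w.IsHamiltonianCycle ∧
      ∀ c : Fin 2, Even ((w.edges.filter (fun e => χ e = c)).length)) :
    ∀ x y : Fin n, x ≠ y →
      (∀ u, G.Adj x u → G.Adj y u → χ s(x, u) = χ s(y, u)) ∨
      (∀ u, G.Adj x u → G.Adj y u → χ s(x, u) ≠ χ s(y, u)) := by
  intro x y hxy
  by_contra hcon
  push Not at hcon
  obtain ⟨⟨u, hxu, hyu, hu⟩, ⟨v, hxv, hyv, hv⟩⟩ := hcon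
  have huv : u ≠ v := by rintro rfl; exact hu hv
  have hdeg : ∀ a, n / 2 + 2 ≤ (G.neighborFinset a).card := fun a => by
    rw [G.card_neighborFinset_eq_degree]
    exact hδ.trans (G.minDegree_le_degree a)
  -- a third common neighbour
  obtain ⟨w, hw⟩ : ∃ w, w ∈ ((G.neighborFinset x ∩ G.neighborFinset y) \ {u, v}) := by
    apply Finset.card_pos.1
    have k1 := Finset.card_union_add_card_inter (G.neighborFinset x) (G.neighborFinset y)
    have k2 : (G.neighborFinset x ∪ G.neighborFinset y).card ≤ n := by
      simpa using Finset.card_le_univ (G.neighborFinset x ∪ G.neighborFinset y)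
    have k3 := Finset.le_card_sdiff {u, v} (G.neighborFinset x ∩ G.neighborFinset y)
    have k4 : ({u, v} : Finset (Fin n)).card ≤ 2 := Finset.card_le_two
    have := hdeg x
    have := hdeg y
    obtain ⟨m, rfl⟩ := hne
    omega
  simp only [Finset.mem_sdiff, Finset.mem_inter, SimpleGraph.mem_neighborFinset,
    Finset.mem_insert, Finset.mem_singleton, not_or] at hw
  obtain ⟨⟨hxw, hyw⟩, hwu, hwv⟩ := hw
  let T : Finset (Fin n) := Finset.univ \ {x, w, y}
  have hT : ∀ z, z ∈ T ↔ (z ≠ x ∧ z ≠ w ∧ z ≠ y) := by intro z; simp [T]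
  have h3 : ({x, w, y} : Finset (Fin n)).card = 3 :=
    Finset.card_eq_three.2 ⟨x, w, y, hxw.ne, hxy, hyw.ne', rfl⟩
  have hTc : T.card = n - 3 := by
    simp only [T]
    rw [Finset.card_sdiff_of_subset (Finset.subset_univ _), h3]; simp
  have huT : u ∈ T := (hT u).2 ⟨hxu.ne', Ne.symm hwu, hyu.ne'⟩
  have hvT : v ∈ T := (hT v).2 ⟨hxv.ne', Ne.symm hwv, hyv.ne'⟩
  let L : List (Fin n) := u :: (((T.erase u).erase v).toList ++ [v])
  have hLT : L.Perm T.toList := by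
    have a1 : (T.erase u).toList.Perm (v :: ((T.erase u).erase v).toList) := by
      have := Finset.toList_insert (Finset.notMem_erase v (T.erase u))
      rwa [Finset.insert_erase (Finset.mem_erase.2 ⟨huv.symm, hvT⟩)] at this
    have a2 : T.toList.Perm (u :: (T.erase u).toList) := by
      have := Finset.toList_insert (Finset.notMem_erase u T)
      rwa [Finset.insert_erase huT] at this
    exact (((List.perm_append_singleton _ _).trans a1.symm).cons u).trans a2.symm
  obtain ⟨L', p1, p2, p3, p4⟩ := ham_list G _ L rfl (by
    intro a _
    rw [hLT.length_eq, hLT.countP_eq, Finset.length_toList, hTc]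
    have e : T.toList.countP (fun z => G.Adj a z) = (T.filter (fun z => G.Adj a z)).card := by
      rw [← Multiset.coe_countP, Finset.coe_toList, Multiset.countP_eq_card_filter]
      rfl
    rw [e]
    have e2 : T.filter (fun z => G.Adj a z) = G.neighborFinset a \ {x, w, y} := by
      ext z; simp [T, and_comm]
    rw [e2]
    have := Finset.le_card_sdiff {x, w, y} (G.neighborFinset a)
    have := hdeg a
    obtain ⟨m, rfl⟩ := hne
    omega)
  have hne' : L' ≠ [] := by
    intro h; rw [h] at p2; simp [L] at p2
  have hnd : L'.Nodup := (p1.trans hLT).nodup_iff.2 T.nodup_toList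
  obtain ⟨p, hps⟩ : ∃ p : G.Walk u v, p.support = L' := by
    have e1 : L'.head hne' = u := by
      rw [List.head?_eq_some_head hne'] at p2; simpa [L] using p2
    have e2 : L'.getLast hne' = v := by
      rw [List.getLast?_eq_some_getLast hne'] at p3
      have : L.getLast? = some v := by simp [L, List.getLast?_cons]
      rw [this] at p3; simpa using p3
    refine ⟨(SimpleGraph.Walk.ofSupport L' hne' p4).copy e1 e2, ?_⟩
    simp
  have hp : p.IsPath := by rw [SimpleGraph.Walk.isPath_def, hps]; exact hnd
  have hs : ∀ z, z ∈ p.support ↔ (z ≠ x ∧ z ≠ w ∧ z ≠ y) := by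
    intro z
    rw [hps, (p1.trans hLT).mem_iff, Finset.mem_toList, hT]
  have r1 := cycle_close hne G χ hno p hp hs hxw.ne hxy hyw.ne' hxv.symm hxw hyw.symm hyu
  have r2 := cycle_close hne G χ hno p hp (x := y) (y := x) (w := w) (by intro z; rw [hs]; tauto)
    hyw.ne hxy.symm hxw.ne' hyv.symm hyw hxw.symm hxu
  rw [Sym2.eq_swap (a := v) (b := x), Sym2.eq_swap (a := w)] at r1
  rw [Sym2.eq_swap (a := v) (b := y), Sym2.eq_swap (a := w)] at r2
  rw [Nat.not_even_iff] at r1 r2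
  rw [hv] at r1
  have hc : ∀ a b : Fin 2, a ≠ b → (a = 0 ∧ b ≠ 0) ∨ (a ≠ 0 ∧ b = 0) := by decide
  rcases hc _ _ hu with ⟨h, h'⟩ | ⟨h, h'⟩ <;> simp only [h, h', if_true, if_false] at r1 r2 <;> omega
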